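/- Let G be a finite simple graph, let S be a maximum critical independent set of G, and let X = N[S]. Then MaxCritIndep(G) ◁ Ω(G[X]), i.e., ⋃MaxCritIndep(G) ⊆ ⋃Ω(G[X]) and ⋂Ω(G[X]) ⊆ ⋂MaxCritIndep(G). -/

import Mathlib

/-- `S` is an independent set in `G`: no two of its vertices are adjacent. -/
def IndepSet {V : Type*} (G : SimpleGraph V) (S : Set V) : Prop :=
  ∀ ⦃u⦄, u ∈ S → ∀ ⦃v⦄, v ∈ S → ¬G.Adj u v

/-- The independence number `α(G)`. -/
noncomputable def indNum {V : Type*} (G : SimpleGraph V) : ℕ :=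
  sSup {n : ℕ | ∃ S : Set V, IndepSet G S ∧ S.ncard = n}

/-- `Ω(G)`: the family of maximum independent sets of `G`. -/
def maxIndepFam {V : Type*} (G : SimpleGraph V) : Set (Set V) :=
  {S | IndepSet G S ∧ S.ncard = indNum G}

/-- `N(X)`: the neighborhood of a set of vertices. -/
def nbhd {V : Type*} (G : SimpleGraph V) (X : Set V) : Set V :=
  {v | ∃ x ∈ X, G.Adj v x}

/-- `N[X] = N(X) ∪ X`: the closed neighborhood of a set of vertices. -/
def closedNbhd {V : Type*} (G : SimpleGraph V) (X : Set V) : Set V :=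
  nbhd G X ∪ X

/-- The difference `d(X) = |X| - |N(X)|`. -/
noncomputable def diffd {V : Type*} (G : SimpleGraph V) (X : Set V) : ℤ :=
  (X.ncard : ℤ) - ((nbhd G X).ncard : ℤ)

/-- The critical difference `d(G) = max {d(X) : X ⊆ V(G)}`. -/
noncomputable def critDiff {V : Type*} (G : SimpleGraph V) : ℤ :=
  sSup {d : ℤ | ∃ X : Set V, diffd G X = d}

/-- `X` is a critical set if `d(X) = d(G)`. -/
def IsCritical {V : Type*} (G : SimpleGraph V) (X : Set V) : Prop :=
  diffd G X = critDiff G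

/-- `MaxCritIndep(G)`: the family of critical independent sets of maximum cardinality. -/
def maxCritIndepFam {V : Type*} (G : SimpleGraph V) : Set (Set V) :=
  {S | IndepSet G S ∧ IsCritical G S ∧
    ∀ T : Set V, IndepSet G T → IsCritical G T → T.ncard ≤ S.ncard}

/-- The critical independence number `α'(G)`. -/
noncomputable def critIndNum {V : Type*} (G : SimpleGraph V) : ℕ :=
  sSup {n : ℕ | ∃ S : Set V, IndepSet G S ∧ IsCritical G S ∧ S.ncard = n}

/-- `ker(G)`: the intersection of all critical independent sets. -/
def kerSet {V : Type*} (G : SimpleGraph V) : Set V :=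
  ⋂₀ {A : Set V | IndepSet G A ∧ IsCritical G A}

/-- `nucleus(G)`: the intersection of all maximum critical independent sets. -/
def nucleus {V : Type*} (G : SimpleGraph V) : Set V :=
  ⋂₀ maxCritIndepFam G

/-- `diadem(G)`: the union of all maximum critical independent sets. -/
def diadem {V : Type*} (G : SimpleGraph V) : Set V :=
  ⋃₀ maxCritIndepFam G

/-- `core(G)`: the intersection of all maximum independent sets. -/
def coreSet {V : Type*} (G : SimpleGraph V) : Set V :=
  ⋂₀ maxIndepFam G

/-- `corona(G)`: the union of all maximum independent sets. -/
def coronaSet {V : Type*} (G : SimpleGraph V) : Set V :=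
  ⋃₀ maxIndepFam G

/-- A matching in `G`: a set of pairwise non-incident edges of `G`. -/
def IsMatchingSet {V : Type*} (G : SimpleGraph V) (M : Set (Sym2 V)) : Prop :=
  M ⊆ G.edgeSet ∧ M.Pairwise fun e f => ∀ v, v ∈ e → v ∉ f

/-- The matching number `μ(G)`. -/
noncomputable def matchNum {V : Type*} (G : SimpleGraph V) : ℕ :=
  sSup {n : ℕ | ∃ M : Set (Sym2 V), IsMatchingSet G M ∧ M.ncard = n}

/-- `G` is a König-Egerváry graph if `α(G) + μ(G) = |V(G)|`. -/
def IsKonigEgervary {V : Type*} (G : SimpleGraph V) : Prop :=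
  indNum G + matchNum G = Nat.card V

/-- `Γ` is a König-Egerváry collection: a family of independent sets with
`|⋂Γ| + |⋃Γ| = 2α(G)`. -/
def IsKECollection {V : Type*} (G : SimpleGraph V) (Γ : Set (Set V)) : Prop :=
  (∀ S ∈ Γ, IndepSet G S) ∧ (⋂₀ Γ).ncard + (⋃₀ Γ).ncard = 2 * indNum G

theorem diffd_le_critDiff {V : Type*} [Finite V] (G : SimpleGraph V) (A : Set V) :
    diffd G A ≤ critDiff G :=
  le_csSup (Set.finite_range (diffd G)).bddAbove ⟨A, rfl⟩

theorem IndepSet.ncard_le_indNum {V : Type*} [Finite V] {G : SimpleGraph V} {A : Set V}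
    (hA : IndepSet G A) : A.ncard ≤ indNum G := by
  refine le_csSup ⟨Nat.card V, ?_⟩ ⟨A, hA, rfl⟩
  rintro n ⟨B, -, rfl⟩
  exact Set.ncard_le_card B

/-- Hall's condition from the neighborhood of a critical set into that set. -/
theorem IsCritical.ncard_le_ncard_inter_nbhd {V : Type*} [Finite V] {G : SimpleGraph V}
    {S J : Set V} (hS : IsCritical G S) (hJ : J ⊆ nbhd G S) :
    J.ncard ≤ (S ∩ nbhd G J).ncard := by
  have hd := diffd_le_critDiff G (S \ nbhd G J)
  rw [← hS] at hd
  have hN : nbhd G (S \ nbhd G J) ⊆ nbhd G S \ J := by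
    rintro v ⟨x, ⟨hxS, hxJ⟩, hvx⟩
    exact ⟨⟨x, hxS, hvx⟩, fun hv => hxJ ⟨v, hv, hvx.symm⟩⟩
  have h1 := Set.ncard_le_ncard hN
  have h2 := Set.ncard_sdiff_add_ncard_of_subset hJ
  have h3 := Set.ncard_inter_add_ncard_sdiff_eq_ncard S (nbhd G J)
  unfold diffd at hd
  omega

theorem IsCritical.ncard_le_of_subset_closedNbhd {V : Type*} [Finite V] {G : SimpleGraph V}
    {S I : Set V} (hS : IsCritical G S) (hI : IndepSet G I) (hIS : I ⊆ closedNbhd G S) :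
    I.ncard ≤ S.ncard := by
  have h1 := hS.ncard_le_ncard_inter_nbhd (J := I \ S)
    fun v hv => (hIS hv.1).resolve_right hv.2
  have h2 : Disjoint (I ∩ S) (S ∩ nbhd G (I \ S)) := by
    rw [Set.disjoint_left]
    rintro v ⟨hvI, -⟩ ⟨-, x, hx, hvx⟩
    exact hI hvI hx.1 hvx
  have h3 := Set.ncard_union_eq h2
  have h4 : (I ∩ S ∪ S ∩ nbhd G (I \ S)).ncard ≤ S.ncard :=
    Set.ncard_le_ncard (Set.union_subset Set.inter_subset_right Set.inter_subset_left)
  have h5 := Set.ncard_inter_add_ncard_sdiff_eq_ncard I S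
  omega

theorem IndepSet.union_sdiff_nbhd {V : Type*} {G : SimpleGraph V} {S T : Set V}
    (hS : IndepSet G S) (hT : IndepSet G T) : IndepSet G (S ∪ T \ nbhd G S) := by
  rintro u (hu | hu) v (hv | hv) huv
  · exact hS hu hv huv
  · exact hv.2 ⟨u, hu, huv.symm⟩
  · exact hu.2 ⟨v, hv, huv⟩
  · exact hT hu.1 hv.1 huv

theorem IsCritical.union_sdiff_nbhd {V : Type*} [Finite V] {G : SimpleGraph V} {S T : Set V}
    (hSi : IndepSet G S) (hS : IsCritical G S) (hT : IsCritical G T) :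
    IsCritical G (S ∪ T \ nbhd G S) := by
  refine le_antisymm (diffd_le_critDiff G _) ?_
  have hJ : (T ∩ nbhd G S).ncard ≤ (S ∩ nbhd G T).ncard :=
    (hS.ncard_le_ncard_inter_nbhd Set.inter_subset_right).trans <| Set.ncard_le_ncard <| by
      rintro v ⟨hv, x, hx, hvx⟩
      exact ⟨hv, x, hx.1, hvx⟩
  have hA : S ∪ T = (S ∪ T \ nbhd G S) ∪ (T ∩ nbhd G S) := by
    rw [Set.union_assoc, Set.sdiff_union_inter]
  have hAcard := Set.ncard_union_le (S ∪ T \ nbhd G S) (T ∩ nbhd G S)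
  rw [← hA] at hAcard
  have hdisj : Disjoint (nbhd G (S ∪ T \ nbhd G S)) (S ∩ nbhd G T) := by
    rw [Set.disjoint_left]
    rintro v ⟨x, hx | hx, hvx⟩ ⟨hv, -⟩
    · exact hSi hv hx hvx
    · exact hx.2 ⟨v, hv, hvx.symm⟩
  have hNcard := Set.ncard_union_eq hdisj
  have hNsub : nbhd G (S ∪ T \ nbhd G S) ∪ S ∩ nbhd G T ⊆ nbhd G S ∪ nbhd G T := by
    rintro v (⟨x, hx | hx, hvx⟩ | ⟨-, hv⟩)
    · exact Or.inl ⟨x, hx, hvx⟩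
    · exact Or.inr ⟨x, hx.1, hvx⟩
    · exact Or.inr hv
  have hNle := Set.ncard_le_ncard hNsub
  have hUnion := Set.ncard_union_add_ncard_inter S T
  have hNUnion := Set.ncard_union_add_ncard_inter (nbhd G S) (nbhd G T)
  have hInter : (nbhd G (S ∩ T)).ncard ≤ (nbhd G S ∩ nbhd G T).ncard :=
    Set.ncard_le_ncard fun v ⟨x, hx, hvx⟩ => ⟨⟨x, hx.1, hvx⟩, ⟨x, hx.2, hvx⟩⟩
  have hd := diffd_le_critDiff G (S ∩ T)
  unfold IsCritical diffd at hS hT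
  unfold diffd at hd ⊢
  omega

theorem subset_closedNbhd_of_mem_maxCritIndepFam {V : Type*} [Finite V] {G : SimpleGraph V}
    {S T : Set V} (hS : S ∈ maxCritIndepFam G) (hTi : IndepSet G T) (hT : IsCritical G T) :
    T ⊆ closedNbhd G S := by
  obtain ⟨hSi, hSc, hmax⟩ := hS
  have hle := hmax _ (hSi.union_sdiff_nbhd hTi) (hSc.union_sdiff_nbhd hSi hT)
  have heq := Set.eq_of_subset_of_ncard_le (Set.subset_union_left (t := T \ nbhd G S)) hle
  intro v hv
  by_cases hvN : v ∈ nbhd G S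
  · exact Or.inl hvN
  · exact Or.inr (heq ▸ Or.inr ⟨hv, hvN⟩)

theorem preimage_mem_maxIndepFam_induce {V : Type*} [Finite V] {G : SimpleGraph V}
    {S T : Set V} (hS : S ∈ maxCritIndepFam G) (hT : T ∈ maxCritIndepFam G) :
    (Subtype.val ⁻¹' T : Set (closedNbhd G S)) ∈
      maxIndepFam (G.induce (closedNbhd G S)) := by
  have hsub := subset_closedNbhd_of_mem_maxCritIndepFam hS hT.1 hT.2.1
  have hind : IndepSet (G.induce (closedNbhd G S)) (Subtype.val ⁻¹' T) :=
    fun u hu v hv huv => hT.1 hu hv huv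
  have hcard : (Subtype.val ⁻¹' T : Set (closedNbhd G S)).ncard = T.ncard :=
    Set.ncard_preimage_of_injective_subset_range Subtype.val_injective (by simpa using hsub)
  refine ⟨hind, le_antisymm hind.ncard_le_indNum ?_⟩
  rw [hcard]
  refine csSup_le ⟨_, _, hind, rfl⟩ ?_
  rintro n ⟨I, hI, rfl⟩
  rw [← Set.ncard_image_of_injective I Subtype.val_injective]
  refine (hS.2.1.ncard_le_of_subset_closedNbhd ?_ ?_).trans (hT.2.2 S hS.1 hS.2.1)
  · rintro _ ⟨u, hu, rfl⟩ _ ⟨v, hv, rfl⟩ huv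
    exact hI hu hv huv
  · rintro _ ⟨u, -, rfl⟩
    exact u.2

/-- If `S` is a maximum critical independent set of `G` and `X = N[S]`,
then `MaxCritIndep(G) ◁ Ω(G[X])`, i.e.
`⋃MaxCritIndep(G) ⊆ ⋃Ω(G[X])` and `⋂Ω(G[X]) ⊆ ⋂MaxCritIndep(G)`
(maximum independent sets of the induced subgraph `G[X]` viewed as subsets of `V(G)`). -/
theorem stmt0 {V : Type*} [Fintype V] (G : SimpleGraph V)
    (S : Set V) (hS : S ∈ maxCritIndepFam G) (X : Set V) (hX : X = closedNbhd G S) :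
    ⋃₀ maxCritIndepFam G ⊆ Subtype.val '' (⋃₀ maxIndepFam (G.induce X)) ∧
    Subtype.val '' (⋂₀ maxIndepFam (G.induce X)) ⊆ ⋂₀ maxCritIndepFam G := by
  subst hX
  constructor
  · rintro v ⟨T, hT, hv⟩
    exact ⟨⟨v, subset_closedNbhd_of_mem_maxCritIndepFam hS hT.1 hT.2.1 hv⟩,
      ⟨_, preimage_mem_maxIndepFam_induce hS hT, hv⟩, rfl⟩
  · rintro _ ⟨v, hv, rfl⟩ T hT
    exact hv _ (preimage_mem_maxIndepFam_induce hS hT)
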